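/- Let μ be the unique real root of 31μ³ − 62μ² + 35μ − 3 (μ ≈ 0.1038149) and let σ > 0 be the unique positive real root of 29791σ⁶ + 231σ² − 79 (σ² ≈ 0.1198689). Then the number of returns to zero of a uniformly random Dyck path with catastrophes of length n is asymptotically Gaussian: for every real x, the fraction of Dyck paths with catastrophes of length n whose number of returns to zero is at most μn + σ√n·x tends, as n → ∞, to Φ(x) = (2π)^{−1/2} ∫_{−∞}^{x} e^{−t²/2} dt. -/

import Mathlib

open Filter Topology

/-- Validity of a path with catastrophes over the jump set `J`, starting from
altitude `h`: each step is either a jump `s ∈ J` keeping the altitude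
nonnegative, or a catastrophe `s = -h` from an altitude `h > 0` with `-h ∉ J`
(landing at altitude `0`). -/
def CatValidFrom (J : Finset ℤ) : ℤ → List ℤ → Prop
  | _, [] => True
  | h, s :: r =>
    ((s ∈ J ∧ 0 ≤ h + s) ∨ (s = -h ∧ 0 < h ∧ -h ∉ J)) ∧ CatValidFrom J (h + s) r

/-- The number of returns to altitude `0` of a path starting at altitude `h`:
the number of steps after which the path is at altitude `0`. -/
def retNum : ℤ → List ℤ → ℕ
  | _, [] => 0
  | h, s :: r => (if h + s = 0 then 1 else 0) + retNum (h + s) r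

/-- The jump set of Dyck paths. For this jump set a catastrophe is a jump
`-h` from an altitude `h ≥ 2` to altitude `0`. -/
def dyckJ : Finset ℤ := {-1, 1}

/-- `l` is a Dyck path with catastrophes of length `n`. -/
def DyckCat (n : ℕ) (l : List ℤ) : Prop :=
  l.length = n ∧ CatValidFrom dyckJ 0 l ∧ l.sum = 0

/-- The number `e n` of Dyck paths with catastrophes of length `n`. -/
noncomputable def eCount (n : ℕ) : ℕ := Nat.card {l : List ℤ // DyckCat n l}

/-- The standard Gaussian cumulative distribution function
`Φ(x) = (2π)^{-1/2} ∫_{-∞}^{x} e^{-t²/2} dt`. -/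
noncomputable def gaussianCDF (x : ℝ) : ℝ :=
  (Real.sqrt (2 * Real.pi))⁻¹ * ∫ t in Set.Iic x, Real.exp (-t ^ 2 / 2)

/-- The set of catastrophe path suffixes of length `n` leading from altitude `h` to altitude `0`. -/
def catPaths : ℕ → ℕ → Finset (List ℤ)
  | 0, 0 => {[]}
  | 0, _ + 1 => ∅
  | n + 1, 0 => (catPaths n 1).map ⟨List.cons 1, List.cons_injective⟩
  | n + 1, 1 => (catPaths n 2).map ⟨List.cons 1, List.cons_injective⟩ ∪
      (catPaths n 0).map ⟨List.cons (-1), List.cons_injective⟩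
  | n + 1, h + 2 => ((catPaths n (h + 3)).map ⟨List.cons 1, List.cons_injective⟩ ∪
      (catPaths n (h + 1)).map ⟨List.cons (-1), List.cons_injective⟩) ∪
      (catPaths n 0).map ⟨List.cons (-((h : ℤ) + 2)), List.cons_injective⟩

theorem mem_catPaths (n h : ℕ) (l : List ℤ) :
    l ∈ catPaths n h ↔ l.length = n ∧ CatValidFrom dyckJ h l ∧ (h : ℤ) + l.sum = 0 := by
  induction n generalizing h l with
  | zero =>
    rw [List.length_eq_zero_iff]
    cases h with
    | zero => simp +contextual [catPaths, CatValidFrom]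
    | succ h =>
      simp only [catPaths, Finset.notMem_empty, false_iff, not_and]
      rintro rfl _ hs
      simp only [List.sum_nil] at hs
      omega
  | succ n ih =>
    cases l with
    | nil => rcases h with _ | _ | h <;> simp [catPaths]
    | cons s r =>
      rcases h with _ | _ | h
      · simp only [catPaths, Finset.mem_map, Function.Embedding.coeFn_mk, List.cons.injEq, ih,
          CatValidFrom, dyckJ, List.length_cons, List.sum_cons, Finset.mem_insert,
          Finset.mem_singleton]
        constructor
        · rintro ⟨_, ⟨h1, h2, h3⟩, rfl, rfl⟩
          refine ⟨by omega, ⟨by simp, by simpa using h2⟩, by push_cast at *; omega⟩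
        · rintro ⟨h1, ⟨h2, h3⟩, h4⟩
          have hs : s = 1 := by simp at h2; omega
          subst hs
          exact ⟨r, ⟨by omega, by simpa using h3, by push_cast at *; omega⟩, rfl, rfl⟩
      · simp only [catPaths, Finset.mem_union, Finset.mem_map, Function.Embedding.coeFn_mk,
          List.cons.injEq, ih, CatValidFrom, dyckJ, List.length_cons, List.sum_cons,
          Finset.mem_insert, Finset.mem_singleton]
        constructor
        · rintro (⟨_, ⟨h1, h2, h3⟩, rfl, rfl⟩ | ⟨_, ⟨h1, h2, h3⟩, rfl, rfl⟩)
          · refine ⟨by omega, ⟨by simp, by simpa using h2⟩, by push_cast at *; omega⟩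
          · refine ⟨by omega, ⟨by simp, by simpa using h2⟩, by push_cast at *; omega⟩
        · rintro ⟨h1, ⟨h2, h3⟩, h4⟩
          have hs : s = 1 ∨ s = -1 := by push_cast at h2; omega
          rcases hs with rfl | rfl
          · exact Or.inl ⟨r, ⟨by omega, by simpa using h3, by push_cast at *; omega⟩, rfl, rfl⟩
          · exact Or.inr ⟨r, ⟨by omega, by simpa using h3, by push_cast at *; omega⟩, rfl, rfl⟩
      · have e1 : ((h + 1 + 1 : ℕ) : ℤ) + 1 = ((h + 3 : ℕ) : ℤ) := by push_cast; ring
        have e2 : ((h + 1 + 1 : ℕ) : ℤ) + -1 = ((h + 1 : ℕ) : ℤ) := by push_cast; ring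
        have e3 : ((h + 1 + 1 : ℕ) : ℤ) + -((h : ℤ) + 2) = ((0 : ℕ) : ℤ) := by push_cast; ring
        simp only [catPaths, Finset.mem_union, Finset.mem_map, Function.Embedding.coeFn_mk,
          List.cons.injEq, ih, CatValidFrom, dyckJ, List.length_cons, List.sum_cons,
          Finset.mem_insert, Finset.mem_singleton]
        constructor
        · rintro ((⟨_, ⟨h1, h2, h3⟩, rfl, rfl⟩ | ⟨_, ⟨h1, h2, h3⟩, rfl, rfl⟩) |
            ⟨_, ⟨h1, h2, h3⟩, rfl, rfl⟩)
          · rw [e1]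
            refine ⟨by omega, ⟨by omega, h2⟩, by push_cast at *; omega⟩
          · rw [e2]
            refine ⟨by omega, ⟨by omega, h2⟩, by push_cast at *; omega⟩
          · rw [e3]
            refine ⟨by omega, ⟨by push_cast; omega, h2⟩, by push_cast at *; omega⟩
        · rintro ⟨h1, ⟨h2, h3⟩, h4⟩
          have hs : s = 1 ∨ s = -1 ∨ s = -((h : ℤ) + 2) := by push_cast at h2; omega
          rcases hs with rfl | rfl | rfl
          · rw [e1] at h3
            exact Or.inl (Or.inl ⟨r, ⟨by omega, h3, by push_cast at *; omega⟩, rfl, rfl⟩)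
          · rw [e2] at h3
            exact Or.inl (Or.inr ⟨r, ⟨by omega, h3, by push_cast at *; omega⟩, rfl, rfl⟩)
          · rw [e3] at h3
            exact Or.inr ⟨r, ⟨by omega, h3, by push_cast at *; omega⟩, rfl, rfl⟩

theorem dyckCat_iff_mem_catPaths (n : ℕ) (l : List ℤ) : DyckCat n l ↔ l ∈ catPaths n 0 := by
  rw [mem_catPaths]
  simp [DyckCat]

/-- The generating polynomial of the number of returns to zero over `catPaths n h`,
evaluated at `u`. -/
def retPoly {R : Type*} [CommRing R] (u : R) (n h : ℕ) : R :=
  ∑ l ∈ catPaths n h, u ^ retNum h l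

section retPoly

variable {R : Type*} [CommRing R] (u : R)

theorem retPoly_zero_zero : retPoly u 0 0 = 1 := by simp [retPoly, catPaths, retNum]

theorem retPoly_zero_succ (h : ℕ) : retPoly u 0 (h + 1) = 0 := by simp [retPoly, catPaths]

theorem retPoly_succ_zero (n : ℕ) : retPoly u (n + 1) 0 = retPoly u n 1 := by
  simp [retPoly, catPaths, retNum]

theorem disjoint_map_cons {a b : ℤ} (hab : a ≠ b) (s t : Finset (List ℤ)) :
    Disjoint (s.map ⟨List.cons a, List.cons_injective⟩)
      (t.map ⟨List.cons b, List.cons_injective⟩) := by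
  simp only [Finset.disjoint_left, Finset.mem_map, Function.Embedding.coeFn_mk]
  rintro _ ⟨l, _, rfl⟩ ⟨l', _, h⟩
  exact hab (List.cons.inj h).1.symm

theorem retPoly_succ_one (n : ℕ) :
    retPoly u (n + 1) 1 = retPoly u n 2 + u * retPoly u n 0 := by
  simp only [retPoly, catPaths]
  rw [Finset.sum_union (disjoint_map_cons (by decide) _ _), Finset.sum_map, Finset.sum_map,
    Finset.mul_sum]
  congr 1
  · exact Finset.sum_congr rfl fun l _ => by simp [retNum]
  · exact Finset.sum_congr rfl fun l _ => by simp [retNum, pow_add]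

theorem retPoly_succ_add_two (n h : ℕ) :
    retPoly u (n + 1) (h + 2) =
      retPoly u n (h + 3) + retPoly u n (h + 1) + u * retPoly u n 0 := by
  simp only [retPoly, catPaths]
  rw [Finset.sum_union, Finset.sum_union (disjoint_map_cons (by decide) _ _), Finset.sum_map,
    Finset.sum_map, Finset.sum_map, Finset.mul_sum]
  · congr 1
    · congr 1
      · refine Finset.sum_congr rfl fun l _ => ?_
        have e : ((h + 2 : ℕ) : ℤ) + 1 = ((h + 3 : ℕ) : ℤ) := by push_cast; ring
        simp only [Function.Embedding.coeFn_mk, retNum, e]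
        rw [if_neg (by omega), zero_add]
      · refine Finset.sum_congr rfl fun l _ => ?_
        have e : ((h + 2 : ℕ) : ℤ) + -1 = ((h + 1 : ℕ) : ℤ) := by push_cast; ring
        simp only [Function.Embedding.coeFn_mk, retNum, e]
        rw [if_neg (by omega), zero_add]
    · refine Finset.sum_congr rfl fun l _ => ?_
      have e : ((h + 2 : ℕ) : ℤ) + -((h : ℤ) + 2) = ((0 : ℕ) : ℤ) := by push_cast; ring
      simp only [Function.Embedding.coeFn_mk, retNum, e]
      simp [pow_add]
  · rw [Finset.disjoint_union_left]
    exact ⟨disjoint_map_cons (by omega) _ _, disjoint_map_cons (by omega) _ _⟩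

end retPoly

/-- The number of paths with `n` steps `±1` starting at altitude `h` that stay nonnegative. -/
def meanderCount : ℕ → ℕ → ℕ
  | 0, _ => 1
  | n + 1, 0 => meanderCount n 1
  | n + 1, h + 1 => meanderCount n (h + 2) + meanderCount n h

theorem meanderCount_le (n h : ℕ) : meanderCount n h ≤ 2 ^ n := by
  induction n generalizing h with
  | zero => simp [meanderCount]
  | succ n ih =>
    rw [pow_succ]
    cases h with
    | zero => linarith [ih 1, show meanderCount (n + 1) 0 = meanderCount n 1 from rfl]
    | succ h => linarith [ih (h + 2), ih h,
        show meanderCount (n + 1) (h + 1) = meanderCount n (h + 2) + meanderCount n h from rfl]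

theorem retPoly_succ_succ {R : Type*} [CommRing R] (u : R) (n h : ℕ) :
    retPoly u (n + 1) (h + 1) =
      u * ∑ p ∈ Finset.HasAntidiagonal.antidiagonal n, (meanderCount p.1 h : R) * retPoly u p.2 0 := by
  induction n generalizing h with
  | zero =>
    cases h with
    | zero => simp [retPoly_succ_one, retPoly_zero_succ, meanderCount]
    | succ h => simp [retPoly_succ_add_two, retPoly_zero_succ, meanderCount]
  | succ n ih =>
    rw [Finset.Nat.sum_antidiagonal_succ]
    cases h with
    | zero =>
      rw [retPoly_succ_one, ih]
      simp only [meanderCount]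
      push_cast
      ring
    | succ h =>
      rw [retPoly_succ_add_two, ih, ih]
      simp only [meanderCount, Nat.cast_add, add_mul, Finset.sum_add_distrib]
      push_cast
      ring

/-- First-passage decomposition: a path of `n + 1` steps `±1` starting at altitude `h` either stays
nonnegative, or reaches `-1` for a first time and is arbitrary afterwards. -/
theorem two_pow_eq_meanderCount_add (n h : ℕ) :
    (2 : ℤ) ^ (n + 1) = meanderCount (n + 1) h + ∑ p ∈ Finset.HasAntidiagonal.antidiagonal n,
      (meanderCount p.1 h - if h = 0 then 0 else (meanderCount p.1 (h - 1) : ℤ)) *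
        meanderCount p.2 0 := by
  induction n generalizing h with
  | zero => rcases h with _ | h <;> simp [meanderCount]
  | succ n ih =>
    rw [Finset.Nat.sum_antidiagonal_succ]
    rcases h with _ | _ | h
    · have h0 := ih 0
      have h1 := ih 1
      simp only [meanderCount, sub_mul, Finset.sum_sub_distrib, if_pos, one_ne_zero,
        Nat.sub_self, if_false, sub_zero, Nat.cast_add] at *
      rw [pow_succ]
      push_cast at *
      linarith
    · have h0 := ih 0
      have h2 := ih 2
      simp [meanderCount, sub_mul, Finset.sum_sub_distrib, add_mul, Finset.sum_add_distrib] at *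
      rw [pow_succ]
      linarith
    · have h0 := ih (h + 1)
      have h2 := ih (h + 3)
      simp [meanderCount, sub_mul, Finset.sum_sub_distrib, add_mul, Finset.sum_add_distrib] at *
      rw [pow_succ]
      linarith

open PowerSeries in
theorem mk_retPoly_eq {R : Type*} [CommRing R] (u : R) :
    (mk fun n => retPoly u n 0) = 1 + C u * X ^ 2 *
      ((mk fun n => (meanderCount n 0 : R)) * mk fun n => retPoly u n 0) := by
  ext n
  rcases n with _ | _ | n
  · simp [retPoly_zero_zero, pow_two, mul_assoc]
  · have : C u * X ^ 2 * ((mk fun n => (meanderCount n 0 : R)) * mk fun n => retPoly u n 0) =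
        C u * (X * ((mk fun n => (meanderCount n 0 : R)) * mk fun n => retPoly u n 0)) * X := by
      ring
    rw [this, map_add, coeff_succ_mul_X]
    simp [retPoly_succ_zero, retPoly_zero_succ, coeff_one]
  · have : C u * X ^ 2 * ((mk fun n => (meanderCount n 0 : R)) * mk fun n => retPoly u n 0) =
        C u * ((mk fun n => (meanderCount n 0 : R)) * mk fun n => retPoly u n 0) * X * X := by
      ring
    rw [this, map_add, coeff_succ_mul_X, coeff_succ_mul_X, coeff_C_mul, coeff_mul, coeff_mk,
      retPoly_succ_zero, retPoly_succ_succ]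
    simp [coeff_one]

open PowerSeries in
theorem mk_meanderCount_eq {R : Type*} [CommRing R] :
    (1 - C 2 * X) * ((mk fun n => (meanderCount n 0 : R)) +
      X * (mk fun n => (meanderCount n 0 : R)) ^ 2) = 1 := by
  have h : (mk fun n => (meanderCount n 0 : R)) +
      X * (mk fun n => (meanderCount n 0 : R)) ^ 2 = mk fun n => (2 : R) ^ n := by
    ext n
    rcases n with _ | n
    · simp [meanderCount]
    · rw [map_add, mul_comm, coeff_succ_mul_X, pow_two, coeff_mul]
      simpa using congrArg (Int.cast : ℤ → R) (two_pow_eq_meanderCount_add n 0).symm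
  rw [h]
  ext n
  rcases n with _ | n
  · simp
  · rw [sub_mul, one_mul, mul_assoc, mul_comm X, ← mul_assoc, map_sub, coeff_succ_mul_X]
    simp [pow_succ, coeff_one, mul_comm]

/-- The coefficients of `(1 - r X) * ∑ n, retPoly u n 0 * X ^ n`. -/
def retDiff {R : Type*} [CommRing R] (u r : R) : ℕ → R
  | 0 => retPoly u 0 0
  | n + 1 => retPoly u (n + 1) 0 - r * retPoly u n 0

/-- The coefficients of the numerator `(1 - 2 X) * (1 + u X + u A)`, where `A` is the generating
function of arches. -/
def retNumer {R : Type*} [CommRing R] (u : R) : ℕ → R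
  | 0 => 1
  | 1 => u - 2
  | 2 => -u
  | n + 3 => u * (meanderCount (n + 1) 0 - 2 * meanderCount n 0)

open PowerSeries in
theorem mk_retNumer {R : Type*} [CommRing R] (u : R) :
    mk (retNumer u) = (1 - C 2 * X) * (1 + C u * X +
      C u * X ^ 2 * mk fun n => (meanderCount n 0 : R)) := by
  have : (1 - C 2 * X) * (1 + C u * X + C u * X ^ 2 * mk fun n => (meanderCount n 0 : R)) =
      1 + (C u - C 2) * X + (C u * ((mk fun n => (meanderCount n 0 : R)) - C 2) -
        C u * (C 2 * (mk fun n => (meanderCount n 0 : R)) * X)) * X * X := by ring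
  rw [this]
  ext n
  rcases n with _ | _ | _ | n
  · simp [retNumer]
  · rw [map_add, map_add, coeff_succ_mul_X, coeff_succ_mul_X]
    simp [retNumer, coeff_one]
  · rw [map_add, map_add, coeff_succ_mul_X, coeff_succ_mul_X, coeff_succ_mul_X]
    simp [retNumer, coeff_one, meanderCount]
    ring
  · rw [map_add, map_add, coeff_succ_mul_X, coeff_succ_mul_X, coeff_succ_mul_X, map_sub (coeff (n + 1)),
      coeff_C_mul, ← mul_assoc, coeff_succ_mul_X, ← mul_assoc, ← map_mul, coeff_C_mul]
    simp [retNumer, coeff_one]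
    ring

/-- The characteristic polynomial, in `r`, of the linear recurrence satisfied by `retPoly u n 0`. -/
def retChar {R : Type*} [CommRing R] (u r : R) : R :=
  r ^ 3 + (u - 2) * r ^ 2 - 2 * u * r - u ^ 2

open PowerSeries in
theorem mk_retDiff_mul {K : Type*} [Field K] {u r : K} (hr : r ≠ 0) (h : retChar u r = 0) :
    mk (retDiff u r) * (1 + C (r + u - 2) * X + C (u ^ 2 / r) * X ^ 2) = mk (retNumer u) := by
  have hD : mk (retDiff u r) = (1 - C r * X) * mk fun n => retPoly u n 0 := by
    ext n
    rcases n with _ | n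
    · simp [retDiff]
    · rw [sub_mul, one_mul, mul_assoc, mul_comm X, ← mul_assoc, map_sub, coeff_succ_mul_X]
      simp [retDiff]
  have hfac : (1 - C r * X) * (1 + C (r + u - 2) * X + C (u ^ 2 / r) * X ^ 2) =
      (1 + C u * X) * (1 - C 2 * X) - C u ^ 2 * X ^ 3 := by
    have h1 : (C (u ^ 2 / r) : K⟦X⟧) = C r * (C r + C u - C 2) - C 2 * C u := by
      simp only [← map_mul, ← map_add, ← map_sub]
      congr 1
      unfold retChar at h
      field_simp
      linear_combination -h
    have h2 : (C r * C (u ^ 2 / r) : K⟦X⟧) = C u ^ 2 := by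
      rw [← map_mul, ← map_pow]
      congr 1
      field_simp
    rw [map_sub, map_add]
    linear_combination X ^ 2 * h1 - X ^ 3 * h2
  have hF := mk_retPoly_eq u
  have hM := mk_meanderCount_eq (R := K)
  rw [hD, mk_retNumer]
  set F : K⟦X⟧ := mk fun n => retPoly u n 0
  set M : K⟦X⟧ := mk fun n => (meanderCount n 0 : K)
  linear_combination F * hfac + (1 - C 2 * X) * (1 + C u * X + C u * X ^ 2 * M) * hF
    + C u ^ 2 * X ^ 3 * F * hM

open PowerSeries in
theorem retDiff_one {K : Type*} [Field K] {u r : K} (hr : r ≠ 0) (h : retChar u r = 0) :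
    retDiff u r 1 + (r + u - 2) * retDiff u r 0 = retNumer u 1 := by
  have := congrArg (PowerSeries.coeff 1) (mk_retDiff_mul hr h)
  rw [mul_add, mul_add, pow_two X, ← mul_assoc, ← mul_assoc, ← mul_assoc, map_add, map_add,
    PowerSeries.coeff_succ_mul_X, PowerSeries.coeff_succ_mul_X] at this
  simpa [mul_comm] using this

open PowerSeries in
theorem retDiff_add_two {K : Type*} [Field K] {u r : K} (hr : r ≠ 0) (h : retChar u r = 0)
    (n : ℕ) :
    retDiff u r (n + 2) + (r + u - 2) * retDiff u r (n + 1) + u ^ 2 / r * retDiff u r n =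
      retNumer u (n + 2) := by
  have := congrArg (PowerSeries.coeff (n + 2)) (mk_retDiff_mul hr h)
  rw [mul_add, mul_add, pow_two X, ← mul_assoc, ← mul_assoc, ← mul_assoc, map_add, map_add,
    PowerSeries.coeff_succ_mul_X, PowerSeries.coeff_succ_mul_X, PowerSeries.coeff_succ_mul_X,
    PowerSeries.coeff_mul_C, PowerSeries.coeff_mul_C] at this
  simpa [mul_comm] using this

theorem retPoly_div_pow {K : Type*} [Field K] {u r : K} (hr : r ≠ 0) (n : ℕ) :
    retPoly u n 0 / r ^ n = ∑ k ∈ Finset.range (n + 1), retDiff u r k / r ^ k := by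
  induction n with
  | zero => simp [retDiff]
  | succ n ih =>
    rw [Finset.sum_range_succ, ← ih, retDiff]
    field_simp
    ring

theorem norm_retNumer_le {u : ℂ} (hu : ‖u‖ = 1) (n : ℕ) : ‖retNumer u n‖ ≤ 3 * 2 ^ n := by
  rcases n with _ | _ | _ | n
  · simp [retNumer]
  · calc ‖retNumer u 1‖ ≤ ‖u‖ + ‖(2 : ℂ)‖ := norm_sub_le _ _
      _ ≤ 3 * 2 ^ 1 := by rw [hu]; norm_num
  · simp only [retNumer, norm_neg, hu]
    norm_num
  · have h1 : ((meanderCount (n + 1) 0 : ℕ) : ℝ) ≤ 2 ^ (n + 1) := by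
      exact_mod_cast meanderCount_le (n + 1) 0
    have h2 : ((meanderCount n 0 : ℕ) : ℝ) ≤ 2 ^ n := by exact_mod_cast meanderCount_le n 0
    have h3 := norm_sub_le ((meanderCount (n + 1) 0 : ℕ) : ℂ) (2 * (meanderCount n 0 : ℕ))
    rw [norm_mul, Complex.norm_natCast, Complex.norm_natCast, Complex.norm_ofNat] at h3
    rw [retNumer, norm_mul, hu, one_mul]
    have h4 : (0 : ℝ) < 2 ^ n := by positivity
    rw [pow_succ] at *
    rw [pow_succ, pow_succ]
    linarith

theorem norm_retDiff_le {u r : ℂ} (hu : ‖u‖ = 1) (hr : r ≠ 0) (h : retChar u r = 0)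
    (h1 : ‖r + u - 2‖ ≤ 6 / 5) (h2 : ‖u ^ 2 / r‖ ≤ 1 / 2) (n : ℕ) :
    ‖retDiff u r n‖ ≤ 12 * 2 ^ n := by
  induction n using Nat.twoStepInduction with
  | zero => simp [retDiff, retPoly_zero_zero]
  | one =>
    have h0 : retDiff u r 0 = 1 := retPoly_zero_zero u
    have e : retDiff u r 1 = retNumer u 1 - (r + u - 2) := by
      linear_combination retDiff_one hr h - (r + u - 2) * h0
    rw [e]
    have := norm_sub_le (retNumer u 1) (r + u - 2)
    have := norm_retNumer_le hu 1
    norm_num at *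
    linarith
  | more n ih1 ih2 =>
    have e : retDiff u r (n + 2) = retNumer u (n + 2) -
        ((r + u - 2) * retDiff u r (n + 1) + u ^ 2 / r * retDiff u r n) := by
      linear_combination retDiff_add_two hr h n
    rw [e]
    have h3 := norm_sub_le (retNumer u (n + 2))
      ((r + u - 2) * retDiff u r (n + 1) + u ^ 2 / r * retDiff u r n)
    have h4 := norm_add_le ((r + u - 2) * retDiff u r (n + 1)) (u ^ 2 / r * retDiff u r n)
    have h5 := norm_retNumer_le hu (n + 2)
    rw [norm_mul, norm_mul] at h4
    have h6 := mul_le_mul h1 ih2 (norm_nonneg _) (by norm_num)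
    have h7 := mul_le_mul h2 ih1 (norm_nonneg _) (by norm_num)
    have h8 : (0 : ℝ) < 2 ^ n := by positivity
    simp only [pow_succ (2 : ℝ)] at *
    linarith

theorem tendsto_retPoly {ι : Type*} {l : Filter ι} {u : ι → ℂ} {a : ℂ} (hu : Tendsto u l (𝓝 a))
    (n h : ℕ) : Tendsto (fun i => retPoly (u i) n h) l (𝓝 (retPoly a n h)) :=
  tendsto_finsetSum _ fun _ _ => hu.pow _

theorem tendsto_retDiff {ι : Type*} {l : Filter ι} {u r : ι → ℂ} {a b : ℂ}
    (hu : Tendsto u l (𝓝 a)) (hr : Tendsto r l (𝓝 b)) (k : ℕ) :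
    Tendsto (fun i => retDiff (u i) (r i) k) l (𝓝 (retDiff a b k)) := by
  cases k with
  | zero => exact tendsto_retPoly hu 0 0
  | succ k => exact (tendsto_retPoly hu (k + 1) 0).sub (hr.mul (tendsto_retPoly hu k 0))

/-- If `u → 1` along the unit circle and `r` is a root of the characteristic polynomial tending to
the dominant root `L`, then `retPoly u n 0 / r ^ n` converges, to a limit independent of `u`. -/
theorem tendsto_retPoly_div_pow {L : ℝ} (hL1 : 214 / 100 < L) (hL2 : L < 215 / 100)
    {u r : ℕ → ℂ} (hu : ∀ n, ‖u n‖ = 1) (hu1 : Tendsto u atTop (𝓝 1))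
    (hr : Tendsto r atTop (𝓝 L)) (h : ∀ n, retChar (u n) (r n) = 0) :
    Tendsto (fun n => retPoly (u n) n 0 / r n ^ n) atTop
      (𝓝 (∑' k, retDiff 1 (L : ℂ) k / (L : ℂ) ^ k)) := by
  have hL0 : (L : ℂ) ≠ 0 := by
    norm_cast
    linarith
  have e1 : ∀ᶠ n in atTop, 21 / 10 < ‖r n‖ := by
    refine hr.norm.eventually_const_lt ?_
    rw [Complex.norm_real, Real.norm_eq_abs, abs_of_pos] <;> linarith
  have e2 : ∀ᶠ n in atTop, ‖r n + u n - 2‖ < 6 / 5 := by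
    refine ((hr.add hu1).sub_const 2).norm.eventually_lt_const ?_
    rw [show (L : ℂ) + 1 - 2 = ((L - 1 : ℝ) : ℂ) by push_cast; ring, Complex.norm_real,
      Real.norm_eq_abs, abs_of_pos] <;> linarith
  have e3 : ∀ᶠ n in atTop, ‖u n ^ 2 / r n‖ < 1 / 2 := by
    refine ((hu1.pow 2).div hr hL0).norm.eventually_lt_const ?_
    rw [one_pow, norm_div, norm_one, Complex.norm_real, Real.norm_eq_abs, abs_of_pos (by linarith)]
    exact one_div_lt_one_div_of_lt (by norm_num) (by linarith)
  have key : Tendsto (fun n => ∑' k, if k ∈ Finset.range (n + 1) then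
      retDiff (u n) (r n) k / r n ^ k else 0) atTop
      (𝓝 (∑' k, retDiff 1 (L : ℂ) k / (L : ℂ) ^ k)) := by
    refine tendsto_tsum_of_dominated_convergence (bound := fun k => 12 * (20 / 21 : ℝ) ^ k)
      ((summable_geometric_of_lt_one (by norm_num) (by norm_num)).mul_left _) ?_ ?_
    · intro k
      have : Tendsto (fun n => retDiff (u n) (r n) k / r n ^ k) atTop
          (𝓝 (retDiff 1 (L : ℂ) k / (L : ℂ) ^ k)) := 
        (tendsto_retDiff hu1 hr k).div (hr.pow k) (pow_ne_zero _ hL0)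
      refine this.congr' ?_
      filter_upwards [eventually_ge_atTop k] with n hn
      rw [if_pos (Finset.mem_range.2 (by omega))]
    · filter_upwards [e1, e2, e3] with n h1 h2 h3 k
      split_ifs
      · have hr0 : r n ≠ 0 := norm_pos_iff.1 (by linarith)
        have h4 := norm_retDiff_le (hu n) hr0 (h n) h2.le h3.le k
        rw [norm_div, norm_pow]
        calc ‖retDiff (u n) (r n) k‖ / ‖r n‖ ^ k ≤ 12 * 2 ^ k / (21 / 10) ^ k := by gcongr
          _ = 12 * (20 / 21 : ℝ) ^ k := by
            rw [mul_div_assoc, ← div_pow]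
            norm_num
      · simp only [norm_zero]
        positivity
  refine key.congr' ?_
  filter_upwards [e1] with n h1
  have hr0 : r n ≠ 0 := norm_pos_iff.1 (by linarith)
  rw [retPoly_div_pow hr0, tsum_eq_sum (s := Finset.range (n + 1)) fun k hk => if_neg hk]
  exact Finset.sum_congr rfl fun k hk => if_pos hk

theorem retPoly_one_lower_bound {L : ℝ} (hL2 : 2 < L) (h : retChar 1 L = 0) (n : ℕ) :
    (L - 2) * L ^ (n + 1) + 2 * meanderCount n 0 / L ≤
      retPoly 1 (n + 2) 0 + (L + 1 - 2) * retPoly 1 (n + 1) 0 + 1 ^ 2 / L * retPoly 1 n 0 := by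
  have hL0 : L ≠ 0 := by linarith
  induction n with
  | zero =>
    have h2 : retPoly (1 : ℝ) 2 0 = 1 := by
      simp [retPoly_succ_zero, retPoly_succ_one, retPoly_zero_zero, retPoly_zero_succ]
    have h1 : retPoly (1 : ℝ) 1 0 = 0 := by simp [retPoly_succ_zero, retPoly_zero_succ]
    rw [h2, h1, retPoly_zero_zero]
    simp only [meanderCount]
    rw [← sub_nonneg]
    unfold retChar at h
    have : 1 + (L + 1 - 2) * 0 + 1 ^ 2 / L * 1 - ((L - 2) * L ^ (0 + 1) + 2 * ((1 : ℕ) : ℝ) / L) =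
        (L - 2) * (L + 1) / L := by
      field_simp
      linear_combination -h
    rw [this]
    exact div_nonneg (mul_nonneg (by linarith) (by linarith)) (by linarith)
  | succ n ih =>
    have hd := retDiff_add_two hL0 h (n + 1)
    simp only [retDiff, retNumer, one_mul] at hd
    have hm : 2 * (meanderCount (n + 1) 0 : ℝ) / L ≤ meanderCount (n + 1) 0 := by
      rw [div_le_iff₀ (by linarith), mul_comm]
      exact mul_le_mul_of_nonneg_left hL2.le (Nat.cast_nonneg _)
    have ih' := mul_le_mul_of_nonneg_left ih (by linarith : (0 : ℝ) ≤ L)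
    have e : L * ((L - 2) * L ^ (n + 1) + 2 * meanderCount n 0 / L) =
        (L - 2) * L ^ (n + 1 + 1) + 2 * meanderCount n 0 := by
      field_simp
      ring
    rw [e] at ih'
    linarith

theorem ofReal_retPoly (u : ℝ) (n h : ℕ) : ((retPoly u n h : ℝ) : ℂ) = retPoly (u : ℂ) n h := by
  simp [retPoly]

theorem tsum_retDiff_ne_zero {L : ℝ} (hL1 : 214 / 100 < L) (hL2 : L < 215 / 100)
    (h : retChar 1 L = 0) : (∑' k, retDiff 1 (L : ℂ) k / (L : ℂ) ^ k) ≠ 0 := by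
  intro h0
  have hL0 : L ≠ 0 := by linarith
  have hc : retChar 1 (L : ℂ) = 0 := by
    unfold retChar at *
    exact_mod_cast h
  have ht := tendsto_retPoly_div_pow hL1 hL2 (u := fun _ => 1) (r := fun _ => L) (by simp)
    tendsto_const_nhds tendsto_const_nhds (fun _ => hc)
  rw [h0] at ht
  have ht' : Tendsto (fun n => retPoly (1 : ℝ) n 0 / L ^ n) atTop (𝓝 0) := by
    have := (Complex.continuous_re.tendsto _).comp ht
    rw [Complex.zero_re] at this
    refine this.congr fun n => ?_
    have e : retPoly (1 : ℂ) n 0 / (L : ℂ) ^ n = ((retPoly (1 : ℝ) n 0 / L ^ n : ℝ) : ℂ) := by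
      push_cast
      rw [ofReal_retPoly, Complex.ofReal_one]
    simp only [Function.comp_apply, e, Complex.ofReal_re]
  have hs := ((ht'.comp (tendsto_add_atTop_nat 2)).add
    ((ht'.comp (tendsto_add_atTop_nat 1)).const_mul ((L + 1 - 2) / L))).add
    (ht'.const_mul (1 ^ 2 / L / L ^ 2))
  have hle : (L - 2) / L ≤ 0 + (L + 1 - 2) / L * 0 + 1 ^ 2 / L / L ^ 2 * 0 := by
    refine ge_of_tendsto' hs fun n => ?_
    have hb := retPoly_one_lower_bound (by linarith) h n
    have hm : 0 ≤ 2 * (meanderCount n 0 : ℝ) / L :=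
      div_nonneg (by positivity) (by linarith)
    have hp : 0 < L ^ (n + 2) := pow_pos (by linarith) _
    have hb' : (L - 2) * L ^ (n + 1) / L ^ (n + 2) ≤ _ :=
      div_le_div_of_nonneg_right ((le_add_of_nonneg_right hm).trans hb) hp.le
    have e1 : (L - 2) * L ^ (n + 1) / L ^ (n + 2) = (L - 2) / L := by
      field_simp
      ring
    rw [e1] at hb'
    refine hb'.trans_eq ?_
    simp only [Function.comp_apply]
    field_simp
    ring
  have : 0 < (L - 2) / L := div_pos (by linarith) (by linarith)
  linarith

theorem exists_retChar_root_near (u z : ℂ) :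
    ∃ r, retChar u r = 0 ∧ ‖z - r‖ ^ 3 ≤ ‖retChar u z‖ := by
  obtain ⟨r₁, h₁⟩ : ∃ r, retChar u r = 0 := by
    obtain ⟨r, hr⟩ := IsAlgClosed.exists_root
      (Polynomial.X ^ 3 + (Polynomial.C (u - 2) * Polynomial.X ^ 2 +
        Polynomial.C (-2 * u) * Polynomial.X + Polynomial.C (-u ^ 2)) : Polynomial ℂ) (by
      have : (Polynomial.X ^ 3 + (Polynomial.C (u - 2) * Polynomial.X ^ 2 +
        Polynomial.C (-2 * u) * Polynomial.X + Polynomial.C (-u ^ 2)) : Polynomial ℂ).degree = 3 := by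
        compute_degree!
      rw [this]
      decide)
    refine ⟨r, ?_⟩
    simp only [Polynomial.IsRoot.def, Polynomial.eval_add, Polynomial.eval_mul, Polynomial.eval_pow,
      Polynomial.eval_X, Polynomial.eval_C] at hr
    rw [retChar]
    linear_combination hr
  obtain ⟨s, hs⟩ := IsAlgClosed.exists_pow_nat_eq ((r₁ + u - 2) ^ 2 -
    4 * (r₁ * (r₁ + u - 2) - 2 * u)) two_pos
  have hfac : ∀ x, retChar u x =
      (x - r₁) * (x - (-(r₁ + u - 2) + s) / 2) * (x - (-(r₁ + u - 2) - s) / 2) := by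
    intro x
    unfold retChar at *
    linear_combination h₁ + (x - r₁) / 4 * hs
  by_contra! hlt
  have l₁ := hlt r₁ h₁
  have l₂ := hlt ((-(r₁ + u - 2) + s) / 2) (by rw [hfac]; ring)
  have l₃ := hlt ((-(r₁ + u - 2) - s) / 2) (by rw [hfac]; ring)
  rw [hfac z, norm_mul, norm_mul] at l₁ l₂ l₃
  set a := ‖z - r₁‖
  set b := ‖z - (-(r₁ + u - 2) + s) / 2‖
  set c := ‖z - (-(r₁ + u - 2) - s) / 2‖
  have ha : 0 ≤ a := norm_nonneg _
  have hb : 0 ≤ b := norm_nonneg _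
  have hc : 0 ≤ c := norm_nonneg _
  rcases le_total a b with hab | hab
  · rcases le_total a c with hac | hac
    · have : a ^ 3 ≤ a * b * c := by
        calc a ^ 3 = a * a * a := by ring
          _ ≤ a * b * c := by gcongr
      linarith
    · have : c ^ 3 ≤ a * b * c := by
        calc c ^ 3 = c * c * c := by ring
          _ ≤ a * b * c := by
            have := hac.trans hab
            gcongr
      linarith
  · rcases le_total b c with hbc | hbc
    · have : b ^ 3 ≤ a * b * c := by
        calc b ^ 3 = b * b * b := by ring
          _ ≤ a * b * c := by gcongr
      linarith
    · have : c ^ 3 ≤ a * b * c := by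
        calc c ^ 3 = c * c * c := by ring
          _ ≤ a * b * c := by
            have := hbc.trans hab
            gcongr
      linarith

theorem exists_retChar_root_tendsto {L : ℂ} (h : retChar 1 L = 0) {u : ℕ → ℂ}
    (hu : Tendsto u atTop (𝓝 1)) :
    ∃ r : ℕ → ℂ, (∀ n, retChar (u n) (r n) = 0) ∧ Tendsto r atTop (𝓝 L) := by
  choose r hr hr' using fun n => exists_retChar_root_near (u n) L
  refine ⟨r, hr, ?_⟩
  have h0 : Tendsto (fun n => ‖retChar (u n) L‖) atTop (𝓝 0) := by
    have hc : Continuous fun v : ℂ => ‖retChar v L‖ := by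
      unfold retChar
      fun_prop
    have := (hc.tendsto 1).comp hu
    rwa [h, norm_zero] at this
  rw [Metric.tendsto_atTop]
  intro ε hε
  obtain ⟨N, hN⟩ := (h0.eventually_lt_const (pow_pos hε 3)).exists_forall_of_atTop
  refine ⟨N, fun n hn => ?_⟩
  rw [dist_comm, dist_eq_norm]
  exact lt_of_pow_lt_pow_left₀ 3 hε.le ((hr' n).trans_lt (hN n hn))

/-- Second-order Taylor expansion of `exp (i κ θ)` at `θ = t / √n`. -/
theorem tendsto_nat_mul_exp_sub (κ t : ℝ) :
    Tendsto (fun n : ℕ => (n : ℂ) * (Complex.exp (κ * (t / √(n : ℝ) : ℝ) * Complex.I) - 1 -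
      κ * (t / √(n : ℝ) : ℝ) * Complex.I)) atTop (𝓝 (-((κ * t) ^ 2 / 2 : ℝ))) := by
  have hθ : Tendsto (fun n : ℕ => κ * (t / √(n : ℝ))) atTop (𝓝 0) := by
    have : Tendsto (fun n : ℕ => √(n : ℝ)) atTop atTop :=
      Real.tendsto_sqrt_atTop.comp tendsto_natCast_atTop_atTop
    simpa using (this.const_div_atTop t).const_mul κ
  rw [← tendsto_sub_nhds_zero_iff]
  have hb : Tendsto (fun n : ℕ => (κ * t) ^ 2 * |κ * (t / √(n : ℝ))|) atTop (𝓝 0) := by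
    simpa using hθ.abs.const_mul ((κ * t) ^ 2)
  refine squeeze_zero_norm' ?_ hb
  have h1 := hθ.abs
  rw [abs_zero] at h1
  filter_upwards [h1.eventually_le_const one_pos, eventually_gt_atTop 0] with n hn hn0
  have hn' : (0 : ℝ) < n := by exact_mod_cast hn0
  have hsq : (n : ℝ) * (κ * (t / √(n : ℝ))) ^ 2 = (κ * t) ^ 2 := by
    rw [mul_pow, div_pow, Real.sq_sqrt hn'.le]
    field_simp
  set x : ℝ := κ * (t / √(n : ℝ)) with hx
  have hxI : ‖(x : ℂ) * Complex.I‖ = |x| := by simp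
  have hexp := Complex.exp_bound (x := x * Complex.I) (by rw [hxI]; exact hn) (n := 3) (by norm_num)
  rw [hxI] at hexp
  have e : (n : ℂ) * (Complex.exp (κ * (t / √(n : ℝ) : ℝ) * Complex.I) - 1 -
      κ * (t / √(n : ℝ) : ℝ) * Complex.I) - (-((κ * t) ^ 2 / 2 : ℝ)) =
      n * (Complex.exp (x * Complex.I) -
        ∑ m ∈ Finset.range 3, (x * Complex.I) ^ m / (m.factorial : ℂ)) := by
    rw [← hsq]
    have : (κ : ℂ) * (t / √(n : ℝ) : ℝ) = (x : ℂ) := by rw [hx]; push_cast; ring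
    rw [this]
    simp only [Finset.sum_range_succ, Finset.sum_range_zero, mul_pow, Complex.I_sq]
    push_cast [Nat.factorial]
    ring
  rw [e, norm_mul, Complex.norm_natCast, ← hsq]
  calc (n : ℝ) * _ ≤ n * (|x| ^ 3 * ((Nat.succ 3 : ℕ) * ((Nat.factorial 3 : ℕ) * (3 : ℕ) : ℝ)⁻¹)) :=
        mul_le_mul_of_nonneg_left hexp hn'.le
    _ ≤ n * (|x| ^ 3 * 1) := by
        gcongr
        norm_num [Nat.factorial]
    _ = n * x ^ 2 * |x| := by
        rw [← sq_abs]
        ring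

theorem tendsto_div_sqrt (t : ℝ) : Tendsto (fun n : ℕ => t / √(n : ℝ)) atTop (𝓝 0) :=
  (Real.tendsto_sqrt_atTop.comp tendsto_natCast_atTop_atTop).const_div_atTop t

/-- Second-order behaviour of the dominant root `r` of the characteristic polynomial at
`u = exp (i t / √n)`. Here `M` and `S` are the mean and variance constants as functions
of `L`. -/
theorem tendsto_root_pow {L M S : ℝ} (hL1 : 214 / 100 < L) (h : retChar 1 L = 0)
    (hM : M = (34 + 5 * L - 9 * L ^ 2) / 31) (hS : S = (97 + 234 * L - 105 * L ^ 2) / 961)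
    (t : ℝ) {r : ℕ → ℂ} (hr : Tendsto r atTop (𝓝 L))
    (hroot : ∀ n : ℕ, retChar (Complex.exp ((t / √(n : ℝ) : ℝ) * Complex.I)) (r n) = 0) :
    Tendsto (fun n : ℕ => (r n / (L * Complex.exp (M * (t / √(n : ℝ) : ℝ) * Complex.I))) ^ n) atTop
      (𝓝 (Complex.exp (-(S * t ^ 2 / 2 : ℝ)))) := by
  have hL0 : (L : ℂ) ≠ 0 := by
    norm_cast
    linarith
  set E : ℝ → ℕ → ℂ := fun κ n => Complex.exp (κ * (t / √(n : ℝ) : ℝ) * Complex.I) with hE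
  have hE1 : ∀ κ, Tendsto (E κ) atTop (𝓝 1) := by
    intro κ
    have hc : Continuous fun x : ℝ => Complex.exp (κ * (x : ℂ) * Complex.I) := by fun_prop
    have h0 := (hc.tendsto 0).comp (tendsto_div_sqrt t)
    rwa [Complex.ofReal_zero, mul_zero, zero_mul, Complex.exp_zero] at h0
  have hEadd : ∀ κ κ' n, E κ n * E κ' n = E (κ + κ') n := by
    intro κ κ' n
    simp only [hE]
    rw [← Complex.exp_add]
    congr 1
    push_cast
    ring
  have hroot' : ∀ n, retChar (E 1 n) (r n) = 0 := fun n => by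
    simpa only [hE, Complex.ofReal_one, one_mul] using hroot n
  set a : ℕ → ℂ := fun n => L * E M n with ha
  have ha0 : ∀ n, a n ≠ 0 := fun n => mul_ne_zero hL0 (Complex.exp_ne_zero _)
  have haL : Tendsto a atTop (𝓝 L) := by simpa using (hE1 M).const_mul (L : ℂ)
  have hchar : Tendsto (fun n : ℕ => (n : ℂ) * retChar (E 1 n) (a n)) atTop
      (𝓝 ((S * t ^ 2 / 2 * (3 * L ^ 3 - 2 * L ^ 2 - 2 * L) : ℝ))) := by
    have h3 := (tendsto_nat_mul_exp_sub (M + M + M) t).const_mul ((L : ℂ) ^ 3)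
    have h2 := (tendsto_nat_mul_exp_sub (1 + (M + M)) t).const_mul ((L : ℂ) ^ 2)
    have h2' := (tendsto_nat_mul_exp_sub (M + M) t).const_mul (-2 * (L : ℂ) ^ 2)
    have h1 := (tendsto_nat_mul_exp_sub (1 + M) t).const_mul (-2 * (L : ℂ))
    have h0 := (tendsto_nat_mul_exp_sub (1 + 1) t).const_mul (-1 : ℂ)
    have hsum := (((h3.add h2).add h2').add h1).add h0
    have hlim : (L : ℂ) ^ 3 * (-(((M + M + M) * t) ^ 2 / 2 : ℝ)) +
        (L : ℂ) ^ 2 * (-(((1 + (M + M)) * t) ^ 2 / 2 : ℝ)) +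
        -2 * (L : ℂ) ^ 2 * (-(((M + M) * t) ^ 2 / 2 : ℝ)) +
        -2 * (L : ℂ) * (-(((1 + M) * t) ^ 2 / 2 : ℝ)) + -1 * (-(((1 + 1) * t) ^ 2 / 2 : ℝ)) =
        ((S * t ^ 2 / 2 * (3 * L ^ 3 - 2 * L ^ 2 - 2 * L) : ℝ) : ℂ) := by
      have hreal : L ^ 3 * (-(((M + M + M) * t) ^ 2 / 2)) +
          L ^ 2 * (-(((1 + (M + M)) * t) ^ 2 / 2)) + -2 * L ^ 2 * (-(((M + M) * t) ^ 2 / 2)) +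
          -2 * L * (-(((1 + M) * t) ^ 2 / 2)) + -1 * (-(((1 + 1) * t) ^ 2 / 2)) =
          S * t ^ 2 / 2 * (3 * L ^ 3 - 2 * L ^ 2 - 2 * L) := by
        rw [hM, hS]
        unfold retChar at h
        linear_combination (-t ^ 2 / 2) * (4 + 956 / 961 * L - 4347 / 961 * L ^ 2
          - 405 / 961 * L ^ 3 + 729 / 961 * L ^ 4) * h
      rw [← hreal]
      push_cast
      ring
    rw [hlim] at hsum
    refine hsum.congr fun n => ?_
    have hexp : retChar (E 1 n) (a n) = L ^ 3 * E (M + M + M) n + L ^ 2 * E (1 + (M + M)) n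
        - 2 * L ^ 2 * E (M + M) n - 2 * L * E (1 + M) n - E (1 + 1) n := by
      simp only [← hEadd, ha, retChar]
      ring
    rw [hexp]
    have hc : (L : ℂ) ^ 3 - L ^ 2 - 2 * L - 1 = 0 := by
      unfold retChar at h
      norm_cast
      linear_combination h
    have hM' : (M : ℂ) = (34 + 5 * L - 9 * L ^ 2) / 31 := by
      rw [hM]
      push_cast
      ring
    have hlin : (L : ℂ) ^ 3 * (M + M + M) + L ^ 2 * (1 + (M + M)) - 2 * L ^ 2 * (M + M)
        - 2 * L * (1 + M) - (1 + 1) = 0 := by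
      rw [hM']
      linear_combination (2 + 6 / 31 * L - 27 / 31 * (L : ℂ) ^ 2) * hc
    simp only [hE]
    push_cast
    linear_combination (-(n : ℂ)) * hc - n * ((t / √(n : ℝ) : ℂ) * Complex.I) * hlin
  set K : ℕ → ℂ := fun n =>
    r n ^ 2 + r n * a n + a n ^ 2 + (E 1 n - 2) * (r n + a n) - 2 * E 1 n with hK
  have hKL : Tendsto K atTop (𝓝 ((3 * L ^ 2 - 2 * L - 2 : ℝ))) := by
    have := ((((hr.pow 2).add (hr.mul haL)).add (haL.pow 2)).add
      (((hE1 1).sub_const 2).mul (hr.add haL))).sub ((hE1 1).const_mul 2)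
    convert this using 2
    push_cast
    ring
  have hK0 : (3 * L ^ 2 - 2 * L - 2 : ℝ) ≠ 0 := by nlinarith
  have hK0' : ((3 * L ^ 2 - 2 * L - 2 : ℝ) : ℂ) ≠ 0 := by exact_mod_cast hK0
  have hdiv := (hchar.div (haL.mul hKL) (mul_ne_zero hL0 hK0')).neg
  have hval : -(((S * t ^ 2 / 2 * (3 * L ^ 3 - 2 * L ^ 2 - 2 * L) : ℝ) : ℂ) /
      (L * (3 * L ^ 2 - 2 * L - 2 : ℝ))) = (-(S * t ^ 2 / 2 : ℝ) : ℂ) := by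
    rw [neg_inj, div_eq_iff (mul_ne_zero hL0 hK0')]
    push_cast
    ring
  rw [hval] at hdiv
  have hg : Tendsto (fun n : ℕ => (n : ℂ) * (r n / a n - 1)) atTop
      (𝓝 (-(S * t ^ 2 / 2 : ℝ))) := by
    refine hdiv.congr' ?_
    filter_upwards [hKL.eventually_ne hK0'] with n hn
    have hkey : (r n - a n) * K n = -retChar (E 1 n) (a n) := by
      have := hroot' n
      simp only [hK]
      unfold retChar at *
      linear_combination this
    have := ha0 n
    change -((n : ℂ) * retChar (E 1 n) (a n) / (a n * K n)) = n * (r n / a n - 1)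
    field_simp
    linear_combination -(n : ℂ) * hkey
  refine (Complex.tendsto_one_add_pow_exp_of_tendsto hg).congr fun n => ?_
  rw [add_sub_cancel]

open MeasureTheory ProbabilityTheory in
theorem gaussianReal_Iic (x : ℝ) :
    (gaussianReal 0 1 (Set.Iic x)).toReal = gaussianCDF x := by
  rw [gaussianReal_apply_eq_integral 0 one_ne_zero, ENNReal.toReal_ofReal
    (integral_nonneg fun y => gaussianPDFReal_nonneg _ _ _), gaussianCDF, ← integral_const_mul]
  simp [gaussianPDFReal]

open MeasureTheory in
/-- The uniform distribution on the values of `f` over `s`. -/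
noncomputable def empiricalMeasure {α : Type*} (s : Finset α) (f : α → ℝ) : Measure ℝ :=
  (s.card : ENNReal)⁻¹ • ∑ a ∈ s, Measure.dirac (f a)

open MeasureTheory in
theorem isProbabilityMeasure_empiricalMeasure {α : Type*} {s : Finset α} (hs : s.card ≠ 0)
    (f : α → ℝ) : IsProbabilityMeasure (empiricalMeasure s f) := by
  constructor
  simp only [empiricalMeasure, Measure.smul_apply, Measure.coe_finsetSum, Finset.sum_apply,
    measure_univ, Finset.sum_const, smul_eq_mul, nsmul_eq_mul, mul_one]
  exact ENNReal.inv_mul_cancel (by exact_mod_cast hs) (ENNReal.natCast_ne_top _)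

open MeasureTheory in
theorem empiricalMeasure_Iic {α : Type*} (s : Finset α) (f : α → ℝ) (x : ℝ) :
    (empiricalMeasure s f (Set.Iic x)).toReal = ({a ∈ s | f a ≤ x}.card : ℝ) / s.card := by
  simp only [empiricalMeasure, Measure.smul_apply, Measure.coe_finsetSum, Finset.sum_apply,
    Measure.dirac_apply' _ measurableSet_Iic, smul_eq_mul, Set.indicator_apply, Set.mem_Iic,
    Pi.one_apply, Finset.sum_boole]
  rw [ENNReal.toReal_mul, ENNReal.toReal_inv, ENNReal.toReal_natCast, ENNReal.toReal_natCast,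
    div_eq_inv_mul]

open MeasureTheory in
theorem charFun_empiricalMeasure {α : Type*} (s : Finset α) (f : α → ℝ) (t : ℝ) :
    charFun (empiricalMeasure s f) t =
      (∑ a ∈ s, Complex.exp (t * f a * Complex.I)) / s.card := by
  rw [charFun_apply_real, empiricalMeasure, integral_smul_measure, integral_finsetSum_measure]
  · simp [integral_dirac, div_eq_inv_mul]
  · intro a _
    exact integrable_dirac (by simp)

open MeasureTheory ProbabilityTheory in
/-- Lévy's continuity theorem for uniform distributions on finite sets, with Gaussian limit. -/
theorem tendsto_card_filter_div_card {α : Type*} {s : ℕ → Finset α} {f : ℕ → α → ℝ}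
    (hs : ∀ᶠ n in atTop, (s n).card ≠ 0)
    (h : ∀ t : ℝ, Tendsto (fun n => (∑ a ∈ s n, Complex.exp (t * f n a * Complex.I)) /
      ((s n).card : ℂ)) atTop (𝓝 (Complex.exp (-(t ^ 2 / 2 : ℝ))))) (x : ℝ) :
    Tendsto (fun n => ({a ∈ s n | f n a ≤ x}.card : ℝ) / (s n).card) atTop
      (𝓝 (gaussianCDF x)) := by
  obtain ⟨N, hN⟩ := hs.exists_forall_of_atTop
  rw [← tendsto_add_atTop_iff_nat N]
  let ν : ℕ → ProbabilityMeasure ℝ := fun n => ⟨empiricalMeasure (s (n + N)) (f (n + N)),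
    isProbabilityMeasure_empiricalMeasure (hN _ (Nat.le_add_left N n)) _⟩
  let γ : ProbabilityMeasure ℝ := ⟨gaussianReal 0 1, inferInstance⟩
  have hν : Tendsto ν atTop (𝓝 γ) := by
    refine ProbabilityMeasure.tendsto_iff_tendsto_charFun.2 fun t => ?_
    have e : charFun (γ : Measure ℝ) t = Complex.exp (-(t ^ 2 / 2 : ℝ)) := by
      change charFun (gaussianReal 0 1) t = _
      rw [charFun_gaussianReal]
      simp
    rw [e]
    refine ((tendsto_add_atTop_iff_nat N).2 (h t)).congr fun n => ?_
    exact (charFun_empiricalMeasure _ _ _).symm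
  have hfr : (γ : Measure ℝ) (frontier (Set.Iic x)) = 0 := by
    have := nullSingletonClass_gaussianReal (μ := 0) (v := 1) one_ne_zero
    rw [frontier_Iic]
    exact measure_singleton (μ := gaussianReal 0 1) x
  have ht := (ENNReal.tendsto_toReal (measure_ne_top _ _)).comp
    (ProbabilityMeasure.tendsto_measure_of_null_frontier_of_tendsto' hν hfr)
  have e : ((γ : Measure ℝ) (Set.Iic x)).toReal = gaussianCDF x := gaussianReal_Iic x
  rw [e] at ht
  exact ht.congr fun n => empiricalMeasure_Iic _ _ _

theorem sum_exp_retNum (σ M t : ℝ) (n : ℕ) :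
    ∑ l ∈ catPaths n 0,
        Complex.exp (t * (((retNum 0 l : ℝ) - M * n) / (σ * √(n : ℝ)) : ℝ) * Complex.I) =
      retPoly (Complex.exp ((t / σ / √(n : ℝ) : ℝ) * Complex.I)) n 0 /
        Complex.exp (M * (t / σ / √(n : ℝ) : ℝ) * Complex.I) ^ n := by
  rw [retPoly, Finset.sum_div]
  refine Finset.sum_congr rfl fun l _ => ?_
  rw [Nat.cast_zero, ← Complex.exp_nat_mul, ← Complex.exp_nat_mul, ← Complex.exp_sub]
  congr 1
  push_cast
  ring

theorem retPoly_one_eq_card (n : ℕ) : retPoly (1 : ℂ) n 0 = (catPaths n 0).card := by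
  simp [retPoly]

theorem tendsto_card_catPaths_div_pow {L : ℝ} (hL1 : 214 / 100 < L) (hL2 : L < 215 / 100)
    (h : retChar 1 L = 0) :
    Tendsto (fun n => ((catPaths n 0).card : ℂ) / (L : ℂ) ^ n) atTop
      (𝓝 (∑' k, retDiff 1 (L : ℂ) k / (L : ℂ) ^ k)) := by
  have hc : retChar 1 (L : ℂ) = 0 := by
    unfold retChar at *
    exact_mod_cast h
  simpa only [retPoly_one_eq_card] using
    tendsto_retPoly_div_pow hL1 hL2 (u := fun _ => 1) (r := fun _ => L) (by simp)
      tendsto_const_nhds tendsto_const_nhds (fun _ => hc)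

theorem eventually_card_catPaths_ne_zero {L : ℝ} (hL1 : 214 / 100 < L) (hL2 : L < 215 / 100)
    (h : retChar 1 L = 0) : ∀ᶠ n in atTop, (catPaths n 0).card ≠ 0 := by
  filter_upwards [(tendsto_card_catPaths_div_pow hL1 hL2 h).eventually_ne
    (tsum_retDiff_ne_zero hL1 hL2 h)] with n hn h0
  simp [h0] at hn

theorem tendsto_charFun_retNum {L M S σ : ℝ} (hL1 : 214 / 100 < L) (hL2 : L < 215 / 100)
    (h : retChar 1 L = 0) (hM : M = (34 + 5 * L - 9 * L ^ 2) / 31)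
    (hS : S = (97 + 234 * L - 105 * L ^ 2) / 961) (t : ℝ) :
    Tendsto (fun n => (∑ l ∈ catPaths n 0,
        Complex.exp (t * (((retNum 0 l : ℝ) - M * n) / (σ * √(n : ℝ)) : ℝ) * Complex.I)) /
          ((catPaths n 0).card : ℂ)) atTop
      (𝓝 (Complex.exp (-(S * (t / σ) ^ 2 / 2 : ℝ)))) := by
  have hL0 : (L : ℂ) ≠ 0 := by exact_mod_cast (by linarith : L ≠ 0)
  have hc : retChar 1 (L : ℂ) = 0 := by
    unfold retChar at *
    exact_mod_cast h
  have hu : Tendsto (fun n : ℕ => Complex.exp ((t / σ / √(n : ℝ) : ℝ) * Complex.I)) atTop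
      (𝓝 1) := by
    have hcont : Continuous fun θ : ℝ => Complex.exp (θ * Complex.I) := by fun_prop
    have h0 := hcont.tendsto 0
    rw [Complex.ofReal_zero, zero_mul, Complex.exp_zero] at h0
    exact h0.comp (tendsto_div_sqrt (t / σ))
  obtain ⟨r, hroot, hr⟩ := exists_retChar_root_tendsto hc hu
  have hE := tsum_retDiff_ne_zero hL1 hL2 h
  have hlim := ((tendsto_retPoly_div_pow hL1 hL2 (fun n => Complex.norm_exp_ofReal_mul_I _) hu hr
    hroot).div (tendsto_card_catPaths_div_pow hL1 hL2 h) hE).mul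
      (tendsto_root_pow hL1 h hM hS (t / σ) hr hroot)
  rw [div_self hE, one_mul] at hlim
  refine hlim.congr' ?_
  filter_upwards [hr.eventually_ne hL0] with n hn
  simp only [Pi.div_apply]
  rw [sum_exp_retNum, div_pow, mul_pow]
  have he := Complex.exp_ne_zero (M * (t / σ / √(n : ℝ) : ℝ) * Complex.I)
  field_simp

theorem exists_retChar_one_root :
    ∃ L : ℝ, 214 / 100 < L ∧ L < 215 / 100 ∧ retChar 1 L = 0 := by
  have hc : ContinuousOn (fun L : ℝ => retChar 1 L) (Set.Icc (214 / 100) (215 / 100)) := by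
    unfold retChar
    fun_prop
  obtain ⟨L, hL, h⟩ := intermediate_value_Ioo (by norm_num) hc
    (show (0 : ℝ) ∈ Set.Ioo _ _ by constructor <;> norm_num [retChar])
  exact ⟨L, hL.1, hL.2, h⟩

theorem mean_eq_of_root {L μ : ℝ} (hL1 : 214 / 100 < L) (hL2 : L < 215 / 100)
    (h : retChar 1 L = 0) (hμ : 31 * μ ^ 3 - 62 * μ ^ 2 + 35 * μ - 3 = 0) :
    μ = (34 + 5 * L - 9 * L ^ 2) / 31 := by
  unfold retChar at h
  obtain ⟨M, hM⟩ : ∃ M, M = (34 + 5 * L - 9 * L ^ 2) / 31 := ⟨_, rfl⟩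
  have hMroot : 31 * M ^ 3 - 62 * M ^ 2 + 35 * M - 3 = 0 := by
    rw [hM]
    linear_combination (-1639 / 961 + 1593 / 961 * L + 486 / 961 * L ^ 2 - 729 / 961 * L ^ 3) * h
  have hM1 : 9 / 100 < M := by rw [hM]; nlinarith
  have hM2 : M < 12 / 100 := by rw [hM]; nlinarith
  have hfac : (μ - M) * (31 * (μ ^ 2 + μ * M + M ^ 2) - 62 * (μ + M) + 35) = 0 := by
    linear_combination hμ - hMroot
  have hpos : 0 < 31 * (μ ^ 2 + μ * M + M ^ 2) - 62 * (μ + M) + 35 := by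
    nlinarith [sq_nonneg (62 * μ + 31 * M - 62)]
  rw [← hM]
  exact sub_eq_zero.1 ((mul_eq_zero.1 hfac).resolve_right hpos.ne')

theorem variance_eq_of_root {L σ : ℝ} (h : retChar 1 L = 0)
    (hσ : 29791 * σ ^ 6 + 231 * σ ^ 2 - 79 = 0) :
    σ ^ 2 = (97 + 234 * L - 105 * L ^ 2) / 961 := by
  unfold retChar at h
  obtain ⟨S, hS⟩ : ∃ S, S = (97 + 234 * L - 105 * L ^ 2) / 961 := ⟨_, rfl⟩
  have hSroot : 29791 * S ^ 3 + 231 * S - 79 = 0 := by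
    rw [hS]
    linear_combination (746199 / 29791 - 9773190 / 29791 * L + 6581925 / 29791 * L ^ 2 -
      1157625 / 29791 * L ^ 3) * h
  have hfac : (σ ^ 2 - S) * (29791 * ((σ ^ 2) ^ 2 + σ ^ 2 * S + S ^ 2) + 231) = 0 := by
    linear_combination hσ - hSroot
  have hpos : 0 < 29791 * ((σ ^ 2) ^ 2 + σ ^ 2 * S + S ^ 2) + 231 := by
    nlinarith [sq_nonneg (σ ^ 2 + S), sq_nonneg (σ ^ 2), sq_nonneg S]
  rw [← hS]
  exact sub_eq_zero.1 ((mul_eq_zero.1 hfac).resolve_right hpos.ne')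

theorem card_dyckCat_and (n : ℕ) (p : List ℤ → Prop) [DecidablePred p] :
    Nat.card {l : List ℤ // DyckCat n l ∧ p l} = {l ∈ catPaths n 0 | p l}.card :=
  Nat.subtype_card _ fun l => by rw [Finset.mem_filter, dyckCat_iff_mem_catPaths]

theorem eCount_eq_card (n : ℕ) : eCount n = (catPaths n 0).card :=
  Nat.subtype_card _ fun l => (dyckCat_iff_mem_catPaths n l).symm

/-- **Gaussian limit law for the number of returns to zero.** Let `μ` be the
unique real root of `31μ³ - 62μ² + 35μ - 3` and `σ > 0` the unique positive
real root of `29791σ⁶ + 231σ² - 79`. For every real `x`, the fraction of Dyck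
paths with catastrophes of length `n` having at most `μn + σ√n·x` returns to
zero tends to `Φ(x)`. -/
theorem retNum_gaussian (μ σ : ℝ)
    (hμ : 31 * μ ^ 3 - 62 * μ ^ 2 + 35 * μ - 3 = 0) (hσpos : 0 < σ)
    (hσ : 29791 * σ ^ 6 + 231 * σ ^ 2 - 79 = 0) (x : ℝ) :
    Tendsto (fun n : ℕ =>
        (Nat.card {l : List ℤ // DyckCat n l ∧
            (retNum 0 l : ℝ) ≤ μ * n + σ * Real.sqrt n * x} : ℝ) /
          (eCount n : ℝ))
      atTop (𝓝 (gaussianCDF x)) := by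
  obtain ⟨L, hL1, hL2, h⟩ := exists_retChar_one_root
  have hM := mean_eq_of_root hL1 hL2 h hμ
  have hS := variance_eq_of_root h hσ
  have hlim := tendsto_card_filter_div_card (s := fun n => catPaths n 0)
    (f := fun n l => ((retNum 0 l : ℝ) - μ * n) / (σ * √(n : ℝ)))
    (eventually_card_catPaths_ne_zero hL1 hL2 h) (fun t => by
      have ht := tendsto_charFun_retNum hL1 hL2 h (σ := σ) hM hS t
      rwa [div_pow, mul_div_cancel₀ _ (pow_ne_zero 2 hσpos.ne')] at ht) x
  refine hlim.congr' ?_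
  filter_upwards [eventually_gt_atTop 0] with n hn
  have hn' : 0 < σ * √(n : ℝ) := mul_pos hσpos (Real.sqrt_pos.2 (Nat.cast_pos.2 hn))
  rw [card_dyckCat_and, eCount_eq_card]
  simp only [div_le_iff₀ hn', sub_le_iff_le_add, mul_comm x, add_comm (μ * (n : ℝ))]
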